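/- If n ≥ 3 is odd, then the spread spd(A_α) = μ₁(A_α) − μ_n(A_α) satisfies spd(A_α) ≥ 2·√( [ (nα²/2)(Δ − δ)² + (2n²α²/(n−2))(2m/n − (Δ+δ)/2)² + 2mn(1−α)² ] / (n² − 1) ). -/

import Mathlib

open Finset

/-- Popoviciu's inequality, sharpened for an odd number `n` of reals in `[a, b]`: the sum of their
squared deviations from the mean is at most `(n ^ 2 - 1) / (4 * n) * (b - a) ^ 2`. By convexity it
suffices to consider families with values in `{a, b}`. -/
lemma sum_sq_sub_sq_sum_div_card_le {ι : Type*} [Fintype ι] (hodd : Odd (Fintype.card ι))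
    {a b : ℝ} (hab : a ≤ b) (x : ι → ℝ) (hx : ∀ i, x i ∈ Set.Icc a b) :
    ∑ i, x i ^ 2 - (∑ i, x i) ^ 2 / Fintype.card ι ≤
      ((Fintype.card ι : ℝ) ^ 2 - 1) / (4 * Fintype.card ι) * (b - a) ^ 2 := by
  have hn : (0 : ℝ) < Fintype.card ι := by exact_mod_cast hodd.pos
  have hdev (y : ι → ℝ) : ∑ i, y i ^ 2 - (∑ i, y i) ^ 2 / Fintype.card ι =
      ∑ i, (y i - (∑ j, y j) / Fintype.card ι) ^ 2 := by
    simp only [sub_sq, sum_add_distrib, sum_sub_distrib, ← sum_mul, ← mul_sum, sum_const,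
      card_univ, nsmul_eq_mul]
    field_simp
    ring
  have hconv : ConvexOn ℝ Set.univ
      (fun y : ι → ℝ ↦ ∑ i, y i ^ 2 - (∑ i, y i) ^ 2 / Fintype.card ι) := by
    refine ⟨convex_univ, fun y _ z _ s t hs ht hst ↦ ?_⟩
    simp only [hdev, smul_eq_mul, Pi.add_apply, Pi.smul_apply, mul_sum, ← sum_add_distrib]
    refine sum_le_sum fun i _ ↦ ?_
    have h := (even_two.convexOn_pow (𝕜 := ℝ)).2
      (Set.mem_univ (y i - (∑ j, y j) / Fintype.card ι))
      (Set.mem_univ (z i - (∑ j, z j) / Fintype.card ι)) hs ht hst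
    simp only [smul_eq_mul] at h
    convert h using 2
    rw [sum_add_distrib, ← mul_sum, ← mul_sum]
    ring
  have hmem : x ∈ convexHull ℝ (Set.univ.pi fun _ : ι ↦ ({a, b} : Set ℝ)) := by
    rw [convexHull_pi]
    intro i _
    rw [convexHull_pair, segment_eq_Icc hab]
    exact hx i
  obtain ⟨y, hy, hxy⟩ := (hconv.subset (Set.subset_univ _)
    (convex_convexHull ℝ _)).exists_ge_of_mem_convexHull (subset_convexHull ℝ _) hmem
  refine hxy.trans ?_
  classical
  set S : Finset ι := univ.filter fun i ↦ y i = b with hS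
  have hyS (i : ι) : y i = a + if i ∈ S then b - a else 0 := by
    have h : y i = a ∨ y i = b := hy i trivial
    simp only [hS, mem_filter, mem_univ, true_and]
    split_ifs with hb
    · linarith
    · simpa [hb] using h
  have hsq (i : ι) : y i ^ 2 = a ^ 2 + if i ∈ S then b ^ 2 - a ^ 2 else 0 := by
    rw [hyS]
    split_ifs <;> ring
  have h1 : ∑ i, y i = Fintype.card ι * a + #S * (b - a) := by
    simp [sum_congr rfl fun i _ ↦ hyS i, sum_add_distrib, mul_sub]
  have h2 : ∑ i, y i ^ 2 = Fintype.card ι * a ^ 2 + #S * (b ^ 2 - a ^ 2) := by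
    simp [sum_congr rfl fun i _ ↦ hsq i, sum_add_distrib, mul_sub]
  have hk : (1 : ℝ) ≤ (2 * #S - Fintype.card ι) ^ 2 := by
    have h : (2 * (#S : ℤ) - Fintype.card ι) ≠ 0 := by
      obtain ⟨r, hr⟩ := hodd
      omega
    have h' : (1 : ℤ) ≤ (2 * (#S : ℤ) - Fintype.card ι) ^ 2 := by
      have := sq_pos_of_ne_zero h
      omega
    exact_mod_cast h'
  simp only [h1, h2]
  have hid : ((Fintype.card ι : ℝ) ^ 2 - 1) / (4 * Fintype.card ι) * (b - a) ^ 2 -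
      (Fintype.card ι * a ^ 2 + #S * (b ^ 2 - a ^ 2) -
        (Fintype.card ι * a + #S * (b - a)) ^ 2 / Fintype.card ι) =
      ((2 * #S - Fintype.card ι) ^ 2 - 1) * (b - a) ^ 2 / (4 * Fintype.card ι) := by
    field_simp
    ring
  rw [← sub_nonneg, hid]
  have := sub_nonneg.2 hk
  positivity

/-- A lower bound for the sum of squared deviations from the mean in terms of two entries. -/
lemma le_sum_sq_sub_sq_sum_div_card {ι : Type*} [Fintype ι] (hcard : 2 < Fintype.card ι)
    (x : ι → ℝ) {p q : ι} (hpq : p ≠ q) :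
    (x p - x q) ^ 2 / 2 + 2 * Fintype.card ι / (Fintype.card ι - 2) *
        ((∑ i, x i) / Fintype.card ι - (x p + x q) / 2) ^ 2 ≤
      ∑ i, x i ^ 2 - (∑ i, x i) ^ 2 / Fintype.card ι := by
  classical
  have hn : (2 : ℝ) < Fintype.card ι := by exact_mod_cast hcard
  have hn' : (0 : ℝ) < Fintype.card ι - 2 := by linarith
  have hsplit (f : ι → ℝ) : ∑ i, f i = f p + f q + ∑ i ∈ ({p, q} : Finset ι)ᶜ, f i := by
    rw [← sum_add_sum_compl {p, q} f, sum_pair hpq]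
  have hcompl : (#({p, q} : Finset ι)ᶜ : ℝ) = Fintype.card ι - 2 := by
    rw [card_compl, card_pair hpq, Nat.cast_sub hcard.le]
    norm_num
  have hcs := sq_sum_le_card_mul_sum_sq (s := ({p, q} : Finset ι)ᶜ) (f := x)
  rw [hcompl] at hcs
  rw [hsplit x, hsplit fun i ↦ x i ^ 2]
  set s := ∑ i ∈ ({p, q} : Finset ι)ᶜ, x i
  set t := ∑ i ∈ ({p, q} : Finset ι)ᶜ, x i ^ 2
  have hst : s ^ 2 / (Fintype.card ι - 2) ≤ t := (div_le_iff₀' hn').2 hcs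
  have hid : x p ^ 2 + x q ^ 2 + s ^ 2 / (Fintype.card ι - 2) -
      (x p + x q + s) ^ 2 / Fintype.card ι = (x p - x q) ^ 2 / 2 +
        2 * Fintype.card ι / (Fintype.card ι - 2) *
          ((x p + x q + s) / Fintype.card ι - (x p + x q) / 2) ^ 2 := by
    have := hn'.ne'
    field_simp
    ring
  linarith

lemma Matrix.IsHermitian.sum_eigenvalues_sq {𝕜 ι : Type*} [RCLike 𝕜] [Fintype ι] [DecidableEq ι]
    {A : Matrix ι ι 𝕜} (hA : A.IsHermitian) :
    ∑ i, hA.eigenvalues i ^ 2 = ∑ i, ∑ j, ‖A i j‖ ^ 2 := by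
  have h1 : (A * A).trace = ∑ i, (hA.eigenvalues i : 𝕜) ^ 2 := by
    conv_lhs => rw [hA.spectral_theorem, ← map_mul, Unitary.conjStarAlgAut_apply,
      Matrix.trace_mul_comm, ← mul_assoc]
    simp [Matrix.trace, sq]
  have h2 : (A * A).trace = ∑ i, ∑ j, (‖A i j‖ : 𝕜) ^ 2 := by
    simp only [Matrix.trace, Matrix.diag_apply, Matrix.mul_apply]
    refine sum_congr rfl fun i _ ↦ sum_congr rfl fun j _ ↦ ?_
    rw [← hA.apply j i, RCLike.star_def, RCLike.mul_conj]
  exact_mod_cast h1.symm.trans h2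

/-- The maximum and minimum degree are attained at two distinct vertices, even if `G` is regular. -/
lemma SimpleGraph.exists_ne_maxDegree_minDegree {V : Type*} [Fintype V] [Nontrivial V]
    (G : SimpleGraph V) [DecidableRel G.Adj] :
    ∃ p q, p ≠ q ∧ G.degree p = G.maxDegree ∧ G.degree q = G.minDegree := by
  obtain ⟨p, hp⟩ := G.exists_maximal_degree_vertex
  obtain ⟨q, hq⟩ := G.exists_minimal_degree_vertex
  by_cases hpq : p = q
  · obtain ⟨r, hr⟩ := exists_ne p
    refine ⟨p, r, hr.symm, hp.symm, le_antisymm ?_ (G.minDegree_le_degree r)⟩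
    rw [hq, ← hpq, ← hp]
    exact G.degree_le_maxDegree r
  · exact ⟨p, q, hpq, hp.symm, hq.symm⟩



theorem stmt_16
    (n m : ℕ) (hn : 3 ≤ n)
    (G : SimpleGraph (Fin n)) [DecidableRel G.Adj]
    (hm : G.edgeFinset.card = m)
    (H : Matrix (Fin n) (Fin n) ℂ) (hHherm : H.IsHermitian)
    (hHdiag : ∀ v, H v v = 0)
    (hHzero : ∀ v u, v ≠ u → ¬ G.Adj v u → H v u = 0)
    (hHedge : ∀ v u, G.Adj v u →
      H v u = 1 ∨ H v u = ((1 + Real.sqrt 3 * Complex.I) / 2 : ℂ) ∨ H v u = (starRingEnd ℂ) ((1 + Real.sqrt 3 * Complex.I) / 2 : ℂ))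
    (α : ℝ) (hα : α ∈ Set.Icc (0 : ℝ) 1)
    (A : Matrix (Fin n) (Fin n) ℂ)
    (hA : A = (α : ℂ) • Matrix.diagonal (fun i => (G.degree i : ℂ)) + ((1 - α : ℝ) : ℂ) • H)
    (hAherm : A.IsHermitian)
    (μ : Fin n → ℝ) (hmono : Antitone μ)
    (hperm : ∃ e : Equiv.Perm (Fin n), μ = hAherm.eigenvalues ∘ e)
    (hodd : Odd n) :
    μ ⟨0, by omega⟩ - μ ⟨n - 1, by omega⟩ ≥ 2 * Real.sqrt (((n : ℝ) * α ^ 2 / 2 * ((G.maxDegree : ℝ) - (G.minDegree : ℝ)) ^ 2 + 2 * (n : ℝ) ^ 2 * α ^ 2 / ((n : ℝ) - 2) * (2 * (m : ℝ) / n - ((G.maxDegree : ℝ) + (G.minDegree : ℝ)) / 2) ^ 2 + 2 * (m : ℝ) * n * (1 - α) ^ 2) / ((n : ℝ) ^ 2 - 1)) := by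
  have hn0 : (0 : ℝ) < n := by exact_mod_cast (by omega : 0 < n)
  have hn3 : (3 : ℝ) ≤ n := by exact_mod_cast hn
  have hn2 : (n : ℝ) - 2 ≠ 0 := by linarith
  have hn1 : (0 : ℝ) < (n : ℝ) ^ 2 - 1 := by nlinarith
  have : Nontrivial (Fin n) := Fin.nontrivial_iff_two_le.2 (by omega)
  have hdeg : ∑ i, (G.degree i : ℝ) = 2 * m := by
    exact_mod_cast hm ▸ G.sum_degrees_eq_twice_card_edges
  have hnorm (i j : Fin n) : ‖A i j‖ ^ 2 =
      (if i = j then α ^ 2 * (G.degree i : ℝ) ^ 2 else 0) +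
        if G.Adj i j then (1 - α) ^ 2 else 0 := by
    have hω : ‖((1 + Real.sqrt 3 * Complex.I) / 2 : ℂ)‖ = 1 := by
      rw [← sq_eq_sq₀ (norm_nonneg _) zero_le_one, ← Complex.normSq_eq_norm_sq]
      simp [Complex.normSq_apply]
      ring_nf
    rcases eq_or_ne i j with rfl | hij
    · simp [hA, hHdiag, mul_pow]
    · by_cases hadj : G.Adj i j
      · have hH : ‖H i j‖ = 1 := by
          rcases hHedge i j hadj with h | h | h <;> rw [h]
          · exact norm_one
          · exact hω
          · rw [RCLike.norm_conj, hω]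
        simp [hA, hij, hadj, hH, -Complex.ofReal_sub]
      · simp [hA, hij, hadj, hHzero i j hij hadj]
  obtain ⟨e, rfl⟩ := hperm
  have hsum : ∑ i, (hAherm.eigenvalues ∘ e) i = 2 * m * α := by
    have h : A.trace = ((2 * m * α : ℝ) : ℂ) := by
      rw [mul_comm, ← hdeg]
      simp [hA, Matrix.trace, hHdiag, mul_sum]
    rw [hAherm.trace_eq_sum_eigenvalues] at h
    rw [← Equiv.sum_comp e] at h
    exact Complex.ofReal_injective ((Complex.ofReal_sum _ _).trans h)
  have hsq : ∑ i, (hAherm.eigenvalues ∘ e) i ^ 2 =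
      α ^ 2 * ∑ i, (G.degree i : ℝ) ^ 2 + (1 - α) ^ 2 * (2 * m) := by
    have h := Equiv.sum_comp e fun i ↦ hAherm.eigenvalues i ^ 2
    rw [Function.comp_def, h, hAherm.sum_eigenvalues_sq, ← hdeg, mul_sum, mul_sum,
      ← sum_add_distrib]
    refine sum_congr rfl fun i _ ↦ ?_
    simp only [hnorm, sum_add_distrib, sum_ite_eq, mem_univ, if_true, ← sum_filter, sum_const,
      ← G.neighborFinset_eq_filter, G.card_neighborFinset_eq_degree, nsmul_eq_mul]
    ring
  set μ := hAherm.eigenvalues ∘ e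
  have hle (i : Fin n) : μ i ∈ Set.Icc (μ ⟨n - 1, by omega⟩) (μ ⟨0, by omega⟩) :=
    ⟨hmono (Fin.le_def.2 (by simp; omega)), hmono (Fin.le_def.2 (by simp))⟩
  have hspread : 0 ≤ μ ⟨0, by omega⟩ - μ ⟨n - 1, by omega⟩ := sub_nonneg.2 (hle _).2
  have hupper := sum_sq_sub_sq_sum_div_card_le (by simpa using hodd) (sub_nonneg.1 hspread) μ hle
  obtain ⟨p, q, hpq, hp, hq⟩ := G.exists_ne_maxDegree_minDegree
  have hlower := le_sum_sq_sub_sq_sum_div_card (by simp; omega) (fun i ↦ (G.degree i : ℝ)) hpq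
  simp only [Fintype.card_fin, hsum, hsq, hdeg, hp, hq] at hupper hlower
  set s := μ ⟨0, by omega⟩ - μ ⟨n - 1, by omega⟩
  set Δ : ℝ := (G.maxDegree : ℝ)
  set δ : ℝ := (G.minDegree : ℝ)
  rw [ge_iff_le, ← le_div_iff₀' two_pos]
  refine Real.sqrt_le_iff.2 ⟨by positivity, ?_⟩
  rw [div_le_iff₀ hn1]
  have hscaled := mul_le_mul_of_nonneg_left hlower (by positivity : 0 ≤ n * α ^ 2)
  have hupper' := mul_le_mul_of_nonneg_left hupper hn0.le
  have hl : n * α ^ 2 * ((Δ - δ) ^ 2 / 2 + 2 * n / (n - 2) * (2 * m / n - (Δ + δ) / 2) ^ 2) =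
      n * α ^ 2 / 2 * (Δ - δ) ^ 2 +
        2 * n ^ 2 * α ^ 2 / (n - 2) * (2 * m / n - (Δ + δ) / 2) ^ 2 := by
    ring
  have hu : n * ((n ^ 2 - 1) / (4 * n) * s ^ 2) = (s / 2) ^ 2 * ((n : ℝ) ^ 2 - 1) := by
    field_simp
    ring
  have hm' : n * (α ^ 2 * ∑ i, (G.degree i : ℝ) ^ 2 + (1 - α) ^ 2 * (2 * m) -
      (2 * m * α) ^ 2 / n) = n * α ^ 2 * (∑ i, (G.degree i : ℝ) ^ 2 - (2 * m) ^ 2 / n) +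
        2 * m * n * (1 - α) ^ 2 := by
    ring
  rw [hl] at hscaled
  rw [hu, hm'] at hupper'
  linarith
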